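/- arXiv:2403.15188 — 4 statements merged into one kernel-verified Lean document; each statement's English description precedes it below -/
import Mathlib

section
/- Let R > 0, v_P > 0, μ ∈ (0,1), α₀ ∈ (0, π], and set T = Rα₀/((1−μ)v_P). Suppose α : [0,T] → ℝ is continuous with α(0) = α₀ and, at every t ∈ [0,T], α has derivative α'(t) = (v_E(t) cos u_E(t) − v_P)/R for some functions with 0 ≤ v_E(t) ≤ μ v_P (the pursuer plays its equilibrium heading u_P = 0, the evader plays arbitrarily). Then α(t) ≤ α₀ − (1−μ)v_P t / R for all t ∈ [0,T]; in particular, if α is nonnegative on [0,T], there exists τ ∈ [0,T] with α(τ) = 0, i.e., capture occurs no later than time Rα₀/((1−μ)v_P). -/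
open Real Set

/-- Pursuer plays its equilibrium heading `u_P = 0`, evader plays arbitrarily
with speed `0 ≤ v_E ≤ μ v_P`.  Then the angular distance decreases at least at rate
`(1-μ) v_P / R`, and if it stays nonnegative on `[0,T]` with `T = R α₀ / ((1-μ) v_P)`,
capture occurs no later than `T`. -/
theorem pursuer_equilibrium_guarantees_capture
    (R vP μ α₀ T : ℝ) (hR : 0 < R) (hvP : 0 < vP) (hμ : μ ∈ Set.Ioo (0 : ℝ) 1)
    (hα₀ : α₀ ∈ Set.Ioc 0 π) (hT : T = R * α₀ / ((1 - μ) * vP))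
    (α vE uE : ℝ → ℝ)
    (hcont : ContinuousOn α (Set.Icc 0 T))
    (h0 : α 0 = α₀)
    (hderiv : ∀ t ∈ Set.Icc 0 T,
      HasDerivWithinAt α ((vE t * Real.cos (uE t) - vP) / R) (Set.Icc 0 T) t)
    (hvE : ∀ t ∈ Set.Icc 0 T, 0 ≤ vE t ∧ vE t ≤ μ * vP) :
    (∀ t ∈ Set.Icc 0 T, α t ≤ α₀ - (1 - μ) * vP * t / R) ∧
    ((∀ t ∈ Set.Icc 0 T, 0 ≤ α t) → ∃ τ ∈ Set.Icc 0 T, α τ = 0) := by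
  have hμ' : 0 < 1 - μ := sub_pos.mpr hμ.2
  have hT0 : 0 ≤ T := by
    have := hα₀.1
    rw [hT]
    positivity
  have hB : ∀ t, HasDerivAt (fun t => α₀ - (1 - μ) * vP * t / R) (-((1 - μ) * vP / R)) t := by
    intro t
    simpa using (((hasDerivAt_id t).const_mul ((1 - μ) * vP)).div_const R).const_sub α₀
  have hbound : ∀ t ∈ Set.Icc 0 T, α t ≤ α₀ - (1 - μ) * vP * t / R := by
    refine image_le_of_deriv_right_le_deriv_boundary hcont
      (fun t ht => ((hderiv t (Ico_subset_Icc_self ht)).mono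
        (Icc_subset_Icc_left ht.1)).mono_of_mem_nhdsWithin (Icc_mem_nhdsGE ht.2))
      (by simp [h0]) (fun t _ => (hB t).continuousAt.continuousWithinAt)
      (fun t _ => (hB t).hasDerivWithinAt) fun t ht => ?_
    obtain ⟨hv0, hv⟩ := hvE t (Ico_subset_Icc_self ht)
    have hcos := mul_le_of_le_one_right hv0 (Real.cos_le_one (uE t))
    rw [← neg_div]
    gcongr
    linarith
  refine ⟨hbound, fun hnonneg => ?_⟩
  have hTmem : T ∈ Set.Icc 0 T := right_mem_Icc.mpr hT0
  refine ⟨T, hTmem, le_antisymm ((hbound T hTmem).trans_eq ?_) (hnonneg T hTmem)⟩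
  rw [hT]
  field_simp
  ring
end

section
/- Let R > 0, v_P > 0, μ ∈ (0,1), α₀ ∈ (0, π], and set T = Rα₀/((1−μ)v_P). Suppose α : [0,T] → ℝ is continuous with α(0) = α₀ and, at every t, α has derivative α'(t) = (μ v_P − v_P cos u_P(t))/R for some function u_P (the evader plays its equilibrium action v_E = μ v_P, u_E = 0, the pursuer plays arbitrarily). Then α(t) ≥ α₀ − (1−μ)v_P t / R for all t ∈ [0,T]; in particular α(t) > 0 for all t < T, i.e., capture cannot occur before time Rα₀/((1−μ)v_P). -/
open Real Set

/-- Evader plays its equilibrium action `(v_E, u_E) = (μ v_P, 0)`, pursuer plays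
arbitrarily.  Then the angular distance decreases at most at rate `(1-μ) v_P / R`, so capture
cannot occur before time `T = R α₀ / ((1-μ) v_P)`. -/
theorem evader_equilibrium_delays_capture
    (R vP μ α₀ T : ℝ) (hR : 0 < R) (hvP : 0 < vP) (hμ : μ ∈ Set.Ioo (0 : ℝ) 1)
    (hα₀ : α₀ ∈ Set.Ioc 0 π) (hT : T = R * α₀ / ((1 - μ) * vP))
    (α uP : ℝ → ℝ)
    (hcont : ContinuousOn α (Set.Icc 0 T))
    (h0 : α 0 = α₀)
    (hderiv : ∀ t ∈ Set.Icc 0 T,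
      HasDerivWithinAt α ((μ * vP - vP * Real.cos (uP t)) / R) (Set.Icc 0 T) t) :
    (∀ t ∈ Set.Icc 0 T, α t ≥ α₀ - (1 - μ) * vP * t / R) ∧
    (∀ t ∈ Set.Ico 0 T, 0 < α t) := by
  have hμ' : 0 < 1 - μ := sub_pos.2 hμ.2
  have hderivAt : ∀ t ∈ interior (Set.Icc 0 T),
      HasDerivAt α ((μ * vP - vP * Real.cos (uP t)) / R) t := by
    intro t ht
    rw [interior_Icc] at ht
    exact (hderiv t (Set.Ioo_subset_Icc_self ht)).hasDerivAt (Icc_mem_nhds ht.1 ht.2)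
  have hlower : ∀ t ∈ Set.Icc 0 T, α t ≥ α₀ - (1 - μ) * vP * t / R := by
    intro t ht
    have h := (convex_Icc 0 T).mul_sub_le_image_sub_of_le_deriv (C := -((1 - μ) * vP / R))
      hcont (fun s hs => (hderivAt s hs).differentiableAt.differentiableWithinAt)
      (fun s hs => by
        rw [(hderivAt s hs).deriv, ← neg_div]
        gcongr
        nlinarith [Real.cos_le_one (uP s)])
      0 (Set.left_mem_Icc.2 (ht.1.trans ht.2)) t ht ht.1
    rw [h0, sub_zero] at h
    have e : (1 - μ) * vP * t / R = (1 - μ) * vP / R * t := by ring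
    linarith
  refine ⟨hlower, fun t ht => ?_⟩
  have htT := ht.2
  rw [hT, lt_div_iff₀ (mul_pos hμ' hvP)] at htT
  have hlt : (1 - μ) * vP * t / R < α₀ := by
    rw [div_lt_iff₀ hR]
    linarith
  linarith [hlower t (Set.Ico_subset_Icc_self ht)]
end

section
/- Let R > 0, v_P > 0, μ ∈ (0,1) and set c = R/((1−μ)v_P). Then the Hamilton–Jacobi–Isaacs value min over u_P ∈ [0,2π] of the max over (v_E, u_E) ∈ [0, μ v_P] × [0,2π] of H(u_P, v_E, u_E) := ((v_E/R) cos u_E − (v_P/R) cos u_P)·c + 1 equals 0; moreover the outer minimum is attained at u_P = 0 and, for u_P = 0, the inner maximum is attained at (v_E, u_E) = (μ v_P, 0). -/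
open Real Set

/-- Against a fixed pursuer heading, the evader's best reply is to flee at full speed `w` straight
away from the pursuer. -/
theorem isMaxOn_hamiltonian_evader {R w c : ℝ} (hR : 0 ≤ R) (hc : 0 ≤ c) (a : ℝ) :
    IsMaxOn (fun p : ℝ × ℝ => ((p.1 / R) * Real.cos p.2 - a) * c + 1)
      (Set.Icc 0 w ×ˢ Set.Icc 0 (2 * π)) (w, 0) := by
  rintro ⟨v, u⟩ ⟨⟨hv0, hvw⟩, -⟩
  have hcos : v / R * Real.cos u ≤ w / R :=
    (mul_le_of_le_one_right (div_nonneg hv0 hR) (Real.cos_le_one u)).trans (by gcongr)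
  simp only [mem_ofPred_eq, Real.cos_zero, mul_one]
  gcongr

theorem sSup_image_eq_of_isMaxOn {α : Type*} {f : α → ℝ} {s : Set α} {a : α} (ha : a ∈ s)
    (h : IsMaxOn f s a) : sSup (f '' s) = f a :=
  IsGreatest.csSup_eq ⟨mem_image_of_mem f ha, forall_mem_image.2 fun _ hx => h hx⟩

theorem sInf_image_eq_of_isMinOn {α : Type*} {f : α → ℝ} {s : Set α} {a : α} (ha : a ∈ s)
    (h : IsMinOn f s a) : sInf (f '' s) = f a :=
  IsLeast.csInf_eq ⟨mem_image_of_mem f ha, forall_mem_image.2 fun _ hx => h hx⟩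

/-- With `c = R/((1-μ) v_P)` (the derivative of the value function), the
Hamilton–Jacobi–Isaacs min–max of the Hamiltonian equals 0; the outer minimum is attained at
`u_P = 0`, and for `u_P = 0` the inner maximum is attained at `(v_E, u_E) = (μ v_P, 0)`. -/
theorem HJI_minmax_zero
    (R vP μ c : ℝ) (hR : 0 < R) (hvP : 0 < vP) (hμ : μ ∈ Set.Ioo (0 : ℝ) 1)
    (hc : c = R / ((1 - μ) * vP))
    (H : ℝ → ℝ → ℝ → ℝ)
    (hH : H = fun uP vE uE => ((vE / R) * Real.cos uE - (vP / R) * Real.cos uP) * c + 1) :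
    sInf ((fun uP => sSup ((fun p : ℝ × ℝ => H uP p.1 p.2) ''
        (Set.Icc 0 (μ * vP) ×ˢ Set.Icc 0 (2 * π)))) '' Set.Icc 0 (2 * π)) = 0 ∧
    IsMinOn (fun uP => sSup ((fun p : ℝ × ℝ => H uP p.1 p.2) ''
        (Set.Icc 0 (μ * vP) ×ˢ Set.Icc 0 (2 * π)))) (Set.Icc 0 (2 * π)) 0 ∧
    IsMaxOn (fun p : ℝ × ℝ => H 0 p.1 p.2)
      (Set.Icc 0 (μ * vP) ×ˢ Set.Icc 0 (2 * π)) (μ * vP, 0) := by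
  obtain ⟨hμ0, hμ1⟩ := hμ
  have hμ' : 0 < 1 - μ := sub_pos.2 hμ1
  have hc0 : 0 ≤ c := by rw [hc]; positivity
  have h0 : (0 : ℝ) ∈ Set.Icc 0 (2 * π) := left_mem_Icc.2 (by positivity)
  have hmax (u : ℝ) : IsMaxOn (fun p : ℝ × ℝ => H u p.1 p.2)
      (Set.Icc 0 (μ * vP) ×ˢ Set.Icc 0 (2 * π)) (μ * vP, 0) := by
    subst hH
    exact isMaxOn_hamiltonian_evader hR.le hc0 _
  have hsup (u : ℝ) : sSup ((fun p : ℝ × ℝ => H u p.1 p.2) ''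
      (Set.Icc 0 (μ * vP) ×ˢ Set.Icc 0 (2 * π))) = H u (μ * vP) 0 :=
    sSup_image_eq_of_isMaxOn (mk_mem_prod (right_mem_Icc.2 (by positivity)) h0) (hmax u)
  simp only [hsup]
  have hmin : IsMinOn (fun u => H u (μ * vP) 0) (Set.Icc 0 (2 * π)) 0 := by
    intro u _
    have hcos : vP / R * Real.cos u ≤ vP / R * Real.cos 0 := by
      rw [Real.cos_zero]
      gcongr
      exact Real.cos_le_one u
    simp only [hH, mem_ofPred_eq]
    gcongr
  refine ⟨?_, hmin, hmax 0⟩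
  rw [sInf_image_eq_of_isMinOn h0 hmin]
  simp only [hH, hc, Real.cos_zero]
  field_simp
  ring
end

section
/- Let R > 0, v_P > 0, μ ∈ (0,1) and let c > 0 be arbitrary. For H(u_P, v_E, u_E) := ((v_E/R) cos u_E − (v_P/R) cos u_P)·c + 1 on the domain u_P ∈ [0,2π], (v_E, u_E) ∈ [0, μ v_P] × [0,2π], the min–max and max–min coincide: min_{u_P} max_{(v_E,u_E)} H = max_{(v_E,u_E)} min_{u_P} H = ((μ v_P − v_P)/R)·c + 1, i.e., the equilibrium (u_P, v_E, u_E) = (0, μ v_P, 0) is a saddle point of the Hamiltonian. -/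
open Real Set

/-- For any `c > 0`, the min–max and max–min of the Hamiltonian coincide and both
equal `((μ v_P - v_P)/R)·c + 1`, i.e. `(u_P, v_E, u_E) = (0, μ v_P, 0)` is a saddle point. -/
theorem hamiltonian_saddle_point
    (R vP μ c : ℝ) (hR : 0 < R) (hvP : 0 < vP) (hμ : μ ∈ Set.Ioo (0 : ℝ) 1) (hc : 0 < c)
    (H : ℝ → ℝ → ℝ → ℝ)
    (hH : H = fun uP vE uE => ((vE / R) * Real.cos uE - (vP / R) * Real.cos uP) * c + 1) :
    sInf ((fun uP => sSup ((fun p : ℝ × ℝ => H uP p.1 p.2) ''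
        (Set.Icc 0 (μ * vP) ×ˢ Set.Icc 0 (2 * π)))) '' Set.Icc 0 (2 * π)) =
      ((μ * vP - vP) / R) * c + 1 ∧
    sSup ((fun p : ℝ × ℝ => sInf ((fun uP => H uP p.1 p.2) '' Set.Icc 0 (2 * π))) ''
        (Set.Icc 0 (μ * vP) ×ˢ Set.Icc 0 (2 * π))) =
      ((μ * vP - vP) / R) * c + 1 := by
  subst hH
  have hμv : 0 ≤ μ * vP := (mul_pos hμ.1 hvP).le
  have h2π : (0 : ℝ) ≤ 2 * π := by positivity
  have evader_bound : ∀ p ∈ Icc 0 (μ * vP) ×ˢ Icc 0 (2 * π),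
      p.1 / R * Real.cos p.2 ≤ μ * vP / R := by
    rintro p ⟨⟨hp0, hp1⟩, -⟩
    calc p.1 / R * Real.cos p.2 ≤ p.1 / R :=
          mul_le_of_le_one_right (by positivity) (Real.cos_le_one _)
      _ ≤ μ * vP / R := by gcongr
  have pursuer_bound : ∀ u : ℝ, vP / R * Real.cos u ≤ vP / R := fun u =>
    mul_le_of_le_one_right (by positivity) (Real.cos_le_one _)
  have inner_max : ∀ u : ℝ,
      sSup ((fun p : ℝ × ℝ => (p.1 / R * Real.cos p.2 - vP / R * Real.cos u) * c + 1) ''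
        (Icc 0 (μ * vP) ×ˢ Icc 0 (2 * π))) =
      (μ * vP / R - vP / R * Real.cos u) * c + 1 := by
    intro u
    apply IsGreatest.csSup_eq
    refine ⟨⟨(μ * vP, 0), ⟨⟨hμv, le_rfl⟩, ⟨le_rfl, h2π⟩⟩, by simp⟩, ?_⟩
    rintro _ ⟨p, hp, rfl⟩
    have := evader_bound p hp
    dsimp only
    gcongr
  have inner_min : ∀ p : ℝ × ℝ,
      sInf ((fun u => (p.1 / R * Real.cos p.2 - vP / R * Real.cos u) * c + 1) ''
        Icc 0 (2 * π)) =
      (p.1 / R * Real.cos p.2 - vP / R) * c + 1 := by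
    intro p
    apply IsLeast.csInf_eq
    refine ⟨⟨0, ⟨le_rfl, h2π⟩, by simp⟩, ?_⟩
    rintro _ ⟨u, -, rfl⟩
    have := pursuer_bound u
    dsimp only
    gcongr
  simp only [inner_max, inner_min, sub_div]
  constructor
  · apply IsLeast.csInf_eq
    refine ⟨⟨0, ⟨le_rfl, h2π⟩, by simp⟩, ?_⟩
    rintro _ ⟨u, -, rfl⟩
    have := pursuer_bound u
    dsimp only
    gcongr
  · apply IsGreatest.csSup_eq
    refine ⟨⟨(μ * vP, 0), ⟨⟨hμv, le_rfl⟩, ⟨le_rfl, h2π⟩⟩, by simp⟩, ?_⟩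
    rintro _ ⟨p, hp, rfl⟩
    have := evader_bound p hp
    dsimp only
    gcongr
end
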